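/- Let u : ℝ⁵ → ℝ be smooth with coordinates (x,y,z,t,t₂) and let λ ∈ ℝ. Define T₂ f = f_{t₂} − (λ² − λ u_{xy} − u_{ty}) f_x − (λ u_{xx} + u_{tx}) f_y and Z₁ f = λ f_z − u_{yz} f_x + u_{zx} f_y on smooth functions f. Then T₂(Z₁ f) − Z₁(T₂ f) = −∂_y(λ M + N) f_x + ∂_x(λ M + N) f_y for every smooth f, where M = u_{zt} + u_{zx} u_{xy} − u_{yz} u_{xx} and N = u_{z t₂} + u_{xz} u_{yt} − u_{yz} u_{xt}. Consequently T₂ and Z₁ commute for every λ ∈ ℝ if and only if ∂_x M = ∂_y M = ∂_x N = ∂_y N = 0; in particular they commute whenever M = 0 and N = 0. -/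

import Mathlib

/-- Partial derivative of `f` in the `i`-th coordinate direction. -/
noncomputable def pd {n : ℕ} (i : Fin n) (f : (Fin n → ℝ) → ℝ) : (Fin n → ℝ) → ℝ :=
  fun p => fderiv ℝ f p (Pi.single i 1)

/-- Coordinates: x = 0, y = 1, z = 2, t = 3, t₂ = 4.
`T₂ f = f_{t₂} − (λ² − λ u_{xy} − u_{ty}) f_x − (λ u_{xx} + u_{tx}) f_y`. -/
noncomputable def T2 (u : (Fin 5 → ℝ) → ℝ) (lam : ℝ) (f : (Fin 5 → ℝ) → ℝ) :
    (Fin 5 → ℝ) → ℝ :=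
  fun q => pd 4 f q - (lam ^ 2 - lam * pd 0 (pd 1 u) q - pd 3 (pd 1 u) q) * pd 0 f q
    - (lam * pd 0 (pd 0 u) q + pd 3 (pd 0 u) q) * pd 1 f q

/-- `Z₁ f = λ f_z − u_{yz} f_x + u_{zx} f_y`. -/
noncomputable def Z1 (u : (Fin 5 → ℝ) → ℝ) (lam : ℝ) (f : (Fin 5 → ℝ) → ℝ) :
    (Fin 5 → ℝ) → ℝ :=
  fun q => lam * pd 2 f q - pd 1 (pd 2 u) q * pd 0 f q + pd 0 (pd 2 u) q * pd 1 f q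

/-- `M = u_{zt} + u_{zx} u_{xy} − u_{yz} u_{xx}`. -/
noncomputable def Mheav (u : (Fin 5 → ℝ) → ℝ) : (Fin 5 → ℝ) → ℝ :=
  fun q => pd 2 (pd 3 u) q + pd 0 (pd 2 u) q * pd 0 (pd 1 u) q
    - pd 1 (pd 2 u) q * pd 0 (pd 0 u) q

/-- `N = u_{z t₂} + u_{xz} u_{yt} − u_{yz} u_{xt}`. -/
noncomputable def Nfun (u : (Fin 5 → ℝ) → ℝ) : (Fin 5 → ℝ) → ℝ :=
  fun q => pd 2 (pd 4 u) q + pd 0 (pd 2 u) q * pd 1 (pd 3 u) q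
    - pd 1 (pd 2 u) q * pd 0 (pd 3 u) q

section PartialDerivatives

variable {n : ℕ} {f g : (Fin n → ℝ) → ℝ}

@[fun_prop]
theorem contDiff_pd (i : Fin n) (hf : ContDiff ℝ (⊤ : ℕ∞) f) :
    ContDiff ℝ (⊤ : ℕ∞) (pd i f) :=
  (hf.fderiv_right (m := (⊤ : ℕ∞)) (by simp)).clm_apply contDiff_const

theorem ContDiff.differentiableAt_of_top (hf : ContDiff ℝ (⊤ : ℕ∞) f) (q : Fin n → ℝ) :
    DifferentiableAt ℝ f q :=
  hf.differentiable (by simp) q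

theorem pd_add (i : Fin n) (hf : ContDiff ℝ (⊤ : ℕ∞) f) (hg : ContDiff ℝ (⊤ : ℕ∞) g)
    (q : Fin n → ℝ) : pd i (fun r => f r + g r) q = pd i f q + pd i g q := by
  simp only [pd]
  rw [fderiv_fun_add (hf.differentiableAt_of_top q) (hg.differentiableAt_of_top q)]
  simp

theorem pd_sub (i : Fin n) (hf : ContDiff ℝ (⊤ : ℕ∞) f) (hg : ContDiff ℝ (⊤ : ℕ∞) g)
    (q : Fin n → ℝ) : pd i (fun r => f r - g r) q = pd i f q - pd i g q := by
  simp only [pd]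
  rw [fderiv_fun_sub (hf.differentiableAt_of_top q) (hg.differentiableAt_of_top q)]
  simp

theorem pd_mul (i : Fin n) (hf : ContDiff ℝ (⊤ : ℕ∞) f) (hg : ContDiff ℝ (⊤ : ℕ∞) g)
    (q : Fin n → ℝ) : pd i (fun r => f r * g r) q = f q * pd i g q + g q * pd i f q := by
  simp only [pd]
  rw [fderiv_fun_mul (hf.differentiableAt_of_top q) (hg.differentiableAt_of_top q)]
  simp

theorem pd_const (i : Fin n) (c : ℝ) (q : Fin n → ℝ) : pd i (fun _ => c) q = 0 := by
  simp [pd]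

theorem pd_coord (i j : Fin n) (q : Fin n → ℝ) :
    pd i (fun r => r j) q = if j = i then 1 else 0 := by
  have h := (ContinuousLinearMap.proj (R := ℝ) (φ := fun _ : Fin n => ℝ) j).hasFDerivAt (x := q)
  change fderiv ℝ (ContinuousLinearMap.proj (R := ℝ) (φ := fun _ : Fin n => ℝ) j) q _ = _
  rw [h.fderiv]
  simp [Pi.single_apply]

/-- Symmetry of second partial derivatives. -/
theorem pd_comm (i j : Fin n) (hf : ContDiff ℝ (⊤ : ℕ∞) f) :
    pd i (pd j f) = pd j (pd i f) := by
  have hd (q) : DifferentiableAt ℝ (fderiv ℝ f) q :=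
    (hf.fderiv_right (m := (⊤ : ℕ∞)) (by simp)).differentiable (by simp) q
  have key (k l : Fin n) (q) :
      pd k (pd l f) q = fderiv ℝ (fderiv ℝ f) q (Pi.single k 1) (Pi.single l 1) := by
    change fderiv ℝ (fun p => fderiv ℝ f p (Pi.single l 1)) q (Pi.single k 1) = _
    rw [fderiv_clm_apply (hd q) (differentiableAt_const _)]
    simp
  ext q
  rw [key, key]
  exact hf.contDiffAt.isSymmSndFDerivAt (by simpa using WithTop.coe_le_coe.2 (le_top (a := (2 : ℕ∞)))) _ _

end PartialDerivatives

section Heavenly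

variable {u : (Fin 5 → ℝ) → ℝ}

theorem contDiff_Mheav (hu : ContDiff ℝ (⊤ : ℕ∞) u) : ContDiff ℝ (⊤ : ℕ∞) (Mheav u) := by
  unfold Mheav; fun_prop

theorem contDiff_Nfun (hu : ContDiff ℝ (⊤ : ℕ∞) u) : ContDiff ℝ (⊤ : ℕ∞) (Nfun u) := by
  unfold Nfun; fun_prop

theorem pd_smul_Mheav_add_Nfun (hu : ContDiff ℝ (⊤ : ℕ∞) u) (i : Fin 5) (lam : ℝ)
    (q : Fin 5 → ℝ) :
    pd i (fun r => lam * Mheav u r + Nfun u r) q = lam * pd i (Mheav u) q + pd i (Nfun u) q := by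
  have hM := contDiff_Mheav hu
  rw [pd_add i (by fun_prop) (contDiff_Nfun hu), pd_mul i contDiff_const hM, pd_const]
  ring

theorem T2_Z1_commutator (hu : ContDiff ℝ (⊤ : ℕ∞) u) (lam : ℝ) {f : (Fin 5 → ℝ) → ℝ}
    (hf : ContDiff ℝ (⊤ : ℕ∞) f) (q : Fin 5 → ℝ) :
    T2 u lam (Z1 u lam f) q - Z1 u lam (T2 u lam f) q =
      -(pd 1 (fun r => lam * Mheav u r + Nfun u r) q) * pd 0 f q
        + pd 0 (fun r => lam * Mheav u r + Nfun u r) q * pd 1 f q := by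
  have symm {g : (Fin 5 → ℝ) → ℝ} (hg : ContDiff ℝ (⊤ : ℕ∞) g) :
      pd 1 (pd 0 g) = pd 0 (pd 1 g) ∧ pd 2 (pd 0 g) = pd 0 (pd 2 g) ∧
      pd 3 (pd 0 g) = pd 0 (pd 3 g) ∧ pd 4 (pd 0 g) = pd 0 (pd 4 g) ∧
      pd 2 (pd 1 g) = pd 1 (pd 2 g) ∧ pd 3 (pd 1 g) = pd 1 (pd 3 g) ∧
      pd 4 (pd 1 g) = pd 1 (pd 4 g) ∧ pd 3 (pd 2 g) = pd 2 (pd 3 g) ∧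
      pd 4 (pd 2 g) = pd 2 (pd 4 g) := by
    refine ⟨?_, ?_, ?_, ?_, ?_, ?_, ?_, ?_, ?_⟩ <;> exact pd_comm _ _ hg
  simp (disch := fun_prop) only [pd_smul_Mheav_add_Nfun hu]
  unfold T2 Z1 Mheav Nfun
  simp (disch := fun_prop) only [pd_add, pd_sub, pd_mul, pd_const, symm hu, symm hf,
    symm (contDiff_pd _ hu)]
  ring

end Heavenly

/-- `T₂(Z₁ f) − Z₁(T₂ f) = −∂_y(λM + N) f_x + ∂_x(λM + N) f_y` for every
smooth `f`; consequently `T₂, Z₁` commute for every `λ` iff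
`∂_x M = ∂_y M = ∂_x N = ∂_y N = 0`, in particular whenever `M = 0` and `N = 0`. -/
theorem stmt5 (u : (Fin 5 → ℝ) → ℝ) (hu : ContDiff ℝ (⊤ : ℕ∞) u) :
    (∀ lam : ℝ, ∀ f : (Fin 5 → ℝ) → ℝ, ContDiff ℝ (⊤ : ℕ∞) f → ∀ q,
        T2 u lam (Z1 u lam f) q - Z1 u lam (T2 u lam f) q =
          -(pd 1 (fun r => lam * Mheav u r + Nfun u r) q) * pd 0 f q
            + pd 0 (fun r => lam * Mheav u r + Nfun u r) q * pd 1 f q)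
    ∧ ((∀ lam : ℝ, ∀ f : (Fin 5 → ℝ) → ℝ, ContDiff ℝ (⊤ : ℕ∞) f → ∀ q,
          T2 u lam (Z1 u lam f) q = Z1 u lam (T2 u lam f) q)
        ↔ (∀ q, pd 0 (Mheav u) q = 0 ∧ pd 1 (Mheav u) q = 0
            ∧ pd 0 (Nfun u) q = 0 ∧ pd 1 (Nfun u) q = 0))
    ∧ (((∀ q, Mheav u q = 0) ∧ (∀ q, Nfun u q = 0)) →
        ∀ lam : ℝ, ∀ f : (Fin 5 → ℝ) → ℝ, ContDiff ℝ (⊤ : ℕ∞) f → ∀ q,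
          T2 u lam (Z1 u lam f) q = Z1 u lam (T2 u lam f) q) := by
  have comm_of_pd_eq_zero (h : ∀ q, pd 0 (Mheav u) q = 0 ∧ pd 1 (Mheav u) q = 0
      ∧ pd 0 (Nfun u) q = 0 ∧ pd 1 (Nfun u) q = 0) (lam : ℝ) (f : (Fin 5 → ℝ) → ℝ)
      (hf : ContDiff ℝ (⊤ : ℕ∞) f) (q : Fin 5 → ℝ) :
      T2 u lam (Z1 u lam f) q = Z1 u lam (T2 u lam f) q := by
    obtain ⟨h1, h2, h3, h4⟩ := h q
    rw [← sub_eq_zero, T2_Z1_commutator hu lam hf, pd_smul_Mheav_add_Nfun hu,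
      pd_smul_Mheav_add_Nfun hu, h1, h2, h3, h4]
    ring
  refine ⟨fun lam f hf q => T2_Z1_commutator hu lam hf q, ⟨fun h q => ?_, comm_of_pd_eq_zero⟩,
    fun ⟨hM, hN⟩ => comm_of_pd_eq_zero fun q => ?_⟩
  · have coord (j : Fin 5) : ContDiff ℝ (⊤ : ℕ∞) (fun r : Fin 5 → ℝ => r j) := by fun_prop
    have hx (lam : ℝ) : lam * pd 1 (Mheav u) q + pd 1 (Nfun u) q = 0 := by
      have := T2_Z1_commutator hu lam (coord 0) q
      rw [h lam _ (coord 0) q] at this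
      simp [pd_smul_Mheav_add_Nfun hu, pd_coord] at this
      linarith
    have hy (lam : ℝ) : lam * pd 0 (Mheav u) q + pd 0 (Nfun u) q = 0 := by
      have := T2_Z1_commutator hu lam (coord 1) q
      rw [h lam _ (coord 1) q] at this
      simp [pd_smul_Mheav_add_Nfun hu, pd_coord] at this
      linarith
    refine ⟨?_, ?_, ?_, ?_⟩ <;> linarith [hx 0, hx 1, hy 0, hy 1]
  · have hM' : Mheav u = fun _ => 0 := funext hM
    have hN' : Nfun u = fun _ => 0 := funext hN
    simp [hM', hN', pd_const]
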